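/- Let s be a Turing degree, let M be an s-computable structure, suppose the Turing degree of EmbedInfo(M) is ≤_T s, and let E be an s-computable cofinal collection in M. Then M is s-computably cofinally ultrahomogeneous with respect to E if and only if M has the s-computable cofinal extension property with respect to E. -/

import Mathlib

/- Self-contained framework for computable ages and cofinal Fraïssé limits. -/

namespace CFL

open Classical

/-! ### Oracle computability -/

/-- The characteristic partial function of a set of naturals. -/
noncomputable def chi (A : Set ℕ) : ℕ →. ℕ :=
  fun n => Part.some (if n ∈ A then 1 else 0)

/-- Codes for oracle partial recursive functions. -/
inductive OCode : Type
  | zero : OCode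
  | succ : OCode
  | left : OCode
  | right : OCode
  | oracle : OCode
  | pair : OCode → OCode → OCode
  | comp : OCode → OCode → OCode
  | prec : OCode → OCode → OCode
  | rfind' : OCode → OCode

/-- Evaluation of an oracle code relative to an oracle `O`. -/
def OCode.eval (O : ℕ →. ℕ) : OCode → ℕ →. ℕ
  | OCode.zero => pure 0
  | OCode.succ => Nat.succ
  | OCode.left => ↑fun n : ℕ => n.unpair.1
  | OCode.right => ↑fun n : ℕ => n.unpair.2
  | OCode.oracle => O
  | OCode.pair cf cg => fun n => Nat.pair <$> OCode.eval O cf n <*> OCode.eval O cg n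
  | OCode.comp cf cg => fun n => OCode.eval O cg n >>= OCode.eval O cf
  | OCode.prec cf cg =>
    Nat.unpaired fun a n =>
      n.rec (OCode.eval O cf a) fun y IH => do
        let i ← IH
        OCode.eval O cg (Nat.pair a (Nat.pair y i))
  | OCode.rfind' cf =>
    Nat.unpaired fun a m =>
      (Nat.rfind fun n => (fun m => m = 0) <$> OCode.eval O cf (Nat.pair a (n + m))).map
        (· + m)

/-- A numerical code of an `OCode`. -/
def OCode.encodeCode : OCode → ℕ
  | OCode.zero => 0
  | OCode.succ => 1
  | OCode.left => 2
  | OCode.right => 3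
  | OCode.oracle => 4
  | OCode.pair cf cg => 4 * Nat.pair cf.encodeCode cg.encodeCode + 5
  | OCode.comp cf cg => 4 * Nat.pair cf.encodeCode cg.encodeCode + 6
  | OCode.prec cf cg => 4 * Nat.pair cf.encodeCode cg.encodeCode + 7
  | OCode.rfind' cf => 4 * cf.encodeCode + 8

/-- `f` is a partial function recursive in the oracle set `O`. -/
def RecFunIn (O : Set ℕ) (f : ℕ →. ℕ) : Prop :=
  ∃ c : OCode, OCode.eval (chi O) c = f

/-- The code `c` computes the total function `f` relative to the oracle set `O`. -/
def ComputesIn (O : Set ℕ) (c : OCode) (f : ℕ → ℕ) : Prop :=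
  ∀ n, OCode.eval (chi O) c n = Part.some (f n)

/-- `f` is a total function computable in the oracle set `O`. -/
def TotalComputableIn (O : Set ℕ) (f : ℕ → ℕ) : Prop :=
  ∃ c : OCode, ComputesIn O c f

/-- The set `A` is computable in the oracle set `O`. -/
def SetRecIn (O A : Set ℕ) : Prop := RecFunIn O (chi A)

/-- Turing reducibility (on sets of naturals, regarded as representatives of
Turing degrees). -/
def TuringLE (A B : Set ℕ) : Prop := SetRecIn B A

/-- The set `A` is computably enumerable in the oracle set `O`. -/
def CEIn (O A : Set ℕ) : Prop :=
  ∃ c : OCode, ∀ n, n ∈ A ↔ (OCode.eval (chi O) c n).Dom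

/-- The Turing jump of a set of naturals. -/
def jump (O : Set ℕ) : Set ℕ :=
  { e | ∃ c : OCode, c.encodeCode = (Nat.unpair e).1 ∧
      (OCode.eval (chi O) c (Nat.unpair e).2).Dom }

/-- `0'`, the jump of the least degree. -/
def zeroJump : Set ℕ := jump ∅

/-- `0''`. -/
def zeroJump2 : Set ℕ := jump zeroJump

/-- `0'''`. -/
def zeroJump3 : Set ℕ := jump zeroJump2

/-! ### Languages and structures -/

/-- A (coded) first-order language: `relArity r = some k` means that `r` is the code of a
relation symbol of arity `k`, and similarly for function symbols. -/
structure Lang where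
  relArity : ℕ → Option ℕ
  funArity : ℕ → Option ℕ

/-- The language is computably represented. -/
def Lang.ComputableRep (L : Lang) : Prop :=
  TotalComputableIn ∅ (fun r => Encodable.encode (L.relArity r)) ∧
  TotalComputableIn ∅ (fun f => Encodable.encode (L.funArity f))

/-- A finite relational language. -/
def Lang.FiniteRelational (L : Lang) : Prop :=
  (∀ f, L.funArity f = none) ∧ { r | (L.relArity r).isSome = true }.Finite

/-- A finite language. -/
def Lang.FiniteLang (L : Lang) : Prop :=
  { r | (L.relArity r).isSome = true }.Finite ∧
  { f | (L.funArity f).isSome = true }.Finite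

/-- An `L`-structure with underlying set a set of naturals. -/
structure Str (L : Lang) where
  dom : Set ℕ
  rel : ℕ → List ℕ → Prop
  fn : ℕ → List ℕ → ℕ
  rel_valid : ∀ r as, rel r as → L.relArity r = some as.length ∧ ∀ x ∈ as, x ∈ dom
  fn_mem : ∀ f as, L.funArity f = some as.length → (∀ x ∈ as, x ∈ dom) → fn f as ∈ dom

variable {L : Lang}

/-- The (finite) tuple `as` lies in the structure `A`. -/
def TupleIn (A : Str L) (as : List ℕ) : Prop := ∀ x ∈ as, x ∈ A.dom

/-- Membership in the substructure of `A` generated by the tuple `s`. -/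
inductive InClosure (A : Str L) (s : List ℕ) : ℕ → Prop
  | base {x : ℕ} : x ∈ s → x ∈ A.dom → InClosure A s x
  | fn (f : ℕ) (as : List ℕ) : L.funArity f = some as.length →
      (∀ x ∈ as, InClosure A s x) → InClosure A s (A.fn f as)

theorem InClosure.mem_dom {A : Str L} {s : List ℕ} {x : ℕ}
    (h : InClosure A s x) : x ∈ A.dom := by
  induction h with
  | base _ hx => exact hx
  | fn f as ha _ ih => exact A.fn_mem f as ha ih

/-- The substructure of `A` generated by the tuple `s`. -/
def Str.sub (A : Str L) (s : List ℕ) : Str L where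
  dom := { x | InClosure A s x }
  rel r as := A.rel r as ∧ ∀ x ∈ as, InClosure A s x
  fn := A.fn
  rel_valid := fun r as h => ⟨(A.rel_valid r as h.1).1, h.2⟩
  fn_mem := fun f as ha hm => InClosure.fn f as ha hm

/-- `h` is an embedding of `A` into `B`. -/
def IsEmbMap (A B : Str L) (h : ℕ → ℕ) : Prop :=
  (∀ x ∈ A.dom, h x ∈ B.dom) ∧
  (∀ x ∈ A.dom, ∀ y ∈ A.dom, h x = h y → x = y) ∧
  (∀ r as, TupleIn A as → (A.rel r as ↔ B.rel r (as.map h))) ∧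
  (∀ f as, L.funArity f = some as.length → TupleIn A as →
    h (A.fn f as) = B.fn f (as.map h))

/-- `A` embeds into `B`. -/
def Embeds (A B : Str L) : Prop := ∃ h, IsEmbMap A B h

/-- `h` is an isomorphism of `A` onto `B`. -/
def IsIsoMap (A B : Str L) (h : ℕ → ℕ) : Prop :=
  IsEmbMap A B h ∧ ∀ y ∈ B.dom, ∃ x ∈ A.dom, h x = y

/-- `A` and `B` are isomorphic. -/
def Isom (A B : Str L) : Prop := ∃ h, IsIsoMap A B h

/-- `as ∼cl bs`: the coordinatewise map extends to an isomorphism of generated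
substructures. -/
def ClSim (A : Str L) (as : List ℕ) (B : Str L) (bs : List ℕ) : Prop :=
  ∃ h : ℕ → ℕ, as.map h = bs ∧ IsIsoMap (A.sub as) (B.sub bs) h

/-- `as ∼tuple bs`: equal length and the same pattern of equalities among coordinates. -/
def TupleSim (as bs : List ℕ) : Prop :=
  ∃ h h' : ℕ → ℕ, as.map h = bs ∧ bs.map h' = as

/-- `A` is finitely generated. -/
def Str.FG (A : Str L) : Prop :=
  ∃ s : List ℕ, TupleIn A s ∧ ∀ x, x ∈ A.dom ↔ InClosure A s x

/-- `g` is an automorphism of `M`. -/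
def IsAutoOf (M : Str L) (g : ℕ → ℕ) : Prop := IsIsoMap M M g

/-! ### Ages (as isomorphism-closed classes) -/

/-- `B` belongs to the age of `M`, i.e. `B` is isomorphic to a finitely generated
substructure of `M`. -/
def AgeMemOf (M : Str L) (B : Str L) : Prop :=
  ∃ as : List ℕ, TupleIn M as ∧ Isom B (M.sub as)

/-- The age of a structure `M`. -/
def ageOf (M : Str L) : Set (Str L) := { B | AgeMemOf M B }

/-- The hereditary property. -/
def HP (C : Set (Str L)) : Prop :=
  ∀ B ∈ C, ∀ as : List ℕ, TupleIn B as → B.sub as ∈ C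

/-- The joint embedding property. -/
def JEP (C : Set (Str L)) : Prop :=
  ∀ A ∈ C, ∀ B ∈ C, ∃ D ∈ C, Embeds A D ∧ Embeds B D

/-- Every pair of embeddings with domain `A` into members of `C` can be amalgamated
over `A` inside `C`. -/
def AmalgamatesOver (C : Set (Str L)) (A : Str L) : Prop :=
  ∀ B₀ ∈ C, ∀ B₁ ∈ C, ∀ f₀ f₁ : ℕ → ℕ, IsEmbMap A B₀ f₀ → IsEmbMap A B₁ f₁ →
    ∃ D ∈ C, ∃ g₀ g₁ : ℕ → ℕ, IsEmbMap B₀ D g₀ ∧ IsEmbMap B₁ D g₁ ∧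
      ∀ x ∈ A.dom, g₀ (f₀ x) = g₁ (f₁ x)

/-- The amalgamation property. -/
def AP (C : Set (Str L)) : Prop := ∀ A ∈ C, AmalgamatesOver C A

/-- `A` is an amalgamation base of the class `C`. -/
def AmalgBase (C : Set (Str L)) (A : Str L) : Prop := A ∈ C ∧ AmalgamatesOver C A

/-- The cofinal amalgamation property. -/
def CoAP (C : Set (Str L)) : Prop :=
  ∀ A ∈ C, ∃ A' : Str L, AmalgBase C A' ∧ Embeds A A'

/-! ### Computable ages -/

/-- An (abstract) enumerated age: for each index `i`, a generating tuple `tup i` and the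
structure `str i` it generates. -/
structure CompAge (L : Lang) where
  tup : ℕ → List ℕ
  str : ℕ → Str L
  tup_mem : ∀ i, TupleIn (str i) (tup i)
  gen : ∀ i x, x ∈ (str i).dom ↔ InClosure (str i) (tup i) x

/-- The class of structures represented by the enumerated age `K`. -/
def CompAge.cls (K : CompAge L) : Set (Str L) := { B | ∃ i, Isom B (K.str i) }

/-- The structure `M` is computable in the oracle set `s`. -/
def StrComputableIn (s : Set ℕ) (M : Str L) : Prop :=
  SetRecIn s M.dom ∧
  SetRecIn s { p | ∃ r as, TupleIn M as ∧ M.rel r as ∧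
      p = Nat.pair r (Encodable.encode as) } ∧
  SetRecIn s { p | ∃ f as b, L.funArity f = some as.length ∧ TupleIn M as ∧
      M.fn f as = b ∧ p = Nat.pair f (Nat.pair (Encodable.encode as) b) }

/-- The coded diagram of an enumerated age. -/
def CompAge.diag (K : CompAge L) : Set ℕ :=
  { p | ∃ i, p = Nat.pair 0 (Nat.pair i (Encodable.encode (K.tup i))) } ∪
  { p | ∃ i x, x ∈ (K.str i).dom ∧ p = Nat.pair 1 (Nat.pair i x) } ∪
  { p | ∃ i r as, TupleIn (K.str i) as ∧ (K.str i).rel r as ∧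
      p = Nat.pair 2 (Nat.pair i (Nat.pair r (Encodable.encode as))) } ∪
  { p | ∃ i r as, TupleIn (K.str i) as ∧ L.relArity r = some as.length ∧
      ¬ (K.str i).rel r as ∧
      p = Nat.pair 3 (Nat.pair i (Nat.pair r (Encodable.encode as))) } ∪
  { p | ∃ i f as b, TupleIn (K.str i) as ∧ L.funArity f = some as.length ∧
      (K.str i).fn f as = b ∧
      p = Nat.pair 4 (Nat.pair i (Nat.pair f (Nat.pair (Encodable.encode as) b))) }

/-- `K` is an `s`-computable age: its diagram is c.e. in `s` and each of its structures
is computable in `s`. -/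
def AgeComputableIn (s : Set ℕ) (K : CompAge L) : Prop :=
  CEIn s K.diag ∧ ∀ i, StrComputableIn s (K.str i)

/-- The embedding information of an enumerated age, as a set of naturals. -/
def EmbedInfo (K : CompAge L) : Set ℕ :=
  { p | ∃ k₀ b₀ k₁ b₁, TupleIn (K.str k₀) b₀ ∧ TupleIn (K.str k₁) b₁ ∧
      ClSim (K.str k₀) b₀ (K.str k₁) b₁ ∧
      p = Nat.pair k₀ (Nat.pair (Encodable.encode b₀)
            (Nat.pair k₁ (Encodable.encode b₁))) }

/-! ### Potential embeddings, spans, and amalgamation diagrams -/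

/-- A potential embedding: a pair of indices and a tuple in the codomain structure. -/
structure PotEmb where
  i : ℕ
  j : ℕ
  c : List ℕ

/-- A numerical code of a potential embedding. -/
def PotEmb.code (F : PotEmb) : ℕ :=
  Nat.pair F.i (Nat.pair F.j (Encodable.encode F.c))

/-- The potential embedding is well-formed with respect to `K`. -/
def PotEmb.Valid (K : CompAge L) (F : PotEmb) : Prop :=
  F.c.length = (K.tup F.i).length ∧ TupleIn (K.str F.j) F.c

/-- The potential embedding is an embedding. -/
def PotEmb.IsEmb (K : CompAge L) (F : PotEmb) : Prop :=
  ClSim (K.str F.i) (K.tup F.i) (K.str F.j) F.c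

/-- The potential embedding is an isomorphism (its range generates the codomain). -/
def PotEmb.IsIso (K : CompAge L) (F : PotEmb) : Prop :=
  F.IsEmb K ∧ ∀ x ∈ (K.str F.j).dom, InClosure (K.str F.j) F.c x

/-- `h` realizes the potential embedding `F` as a map on the domain structure. -/
def ExtMap (K : CompAge L) (F : PotEmb) (h : ℕ → ℕ) : Prop :=
  (K.tup F.i).map h = F.c ∧ IsEmbMap (K.str F.i) (K.str F.j) h

/-- `(F₀, F₁)` is a potential span. -/
def PotSpan (K : CompAge L) (F₀ F₁ : PotEmb) : Prop :=
  F₀.Valid K ∧ F₁.Valid K ∧ F₀.i = F₁.i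

/-- `(G₀, G₁)` is an amalgamation diagram over the potential span `(F₀, F₁)`. -/
def AmalgDiagOver (K : CompAge L) (F₀ F₁ G₀ G₁ : PotEmb) : Prop :=
  G₀.Valid K ∧ G₁.Valid K ∧ G₀.IsEmb K ∧
  G₀.i = F₀.j ∧ G₁.i = F₁.j ∧ G₀.j = G₁.j ∧
  (F₀.IsEmb K → F₁.IsEmb K → G₁.IsEmb K ∧
    ∀ h₀ h₁ : ℕ → ℕ, ExtMap K G₀ h₀ → ExtMap K G₁ h₁ →
      F₀.c.map h₀ = F₁.c.map h₁)

/-- `H` is the composition `F ∘ G` of potential embeddings (where `F` is an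
embedding realized by any `h` extending it). -/
def CompRel (K : CompAge L) (F G H : PotEmb) : Prop :=
  G.j = F.i ∧ H.i = G.i ∧ H.j = F.j ∧
  ∀ h : ℕ → ℕ, ExtMap K F h → H.c = G.c.map h

/-! ### Computable versions of HP, JEP, AP, coAP -/

/-- The `s`-computable hereditary property. -/
def CHP (s : Set ℕ) (K : CompAge L) : Prop :=
  ∃ c : OCode, ∀ i (b : List ℕ), TupleIn (K.str i) b →
    ∃ j, OCode.eval (chi s) c (Nat.pair i (Encodable.encode b)) = Part.some j ∧
      ClSim (K.str j) (K.tup j) (K.str i) b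

/-- The `s`-computable joint embedding property. -/
def CJEP (s : Set ℕ) (K : CompAge L) : Prop :=
  ∃ c : OCode, ∀ i j : ℕ, ∃ F G : PotEmb,
    OCode.eval (chi s) c (Nat.pair i j) = Part.some (Nat.pair F.code G.code) ∧
    F.Valid K ∧ G.Valid K ∧ F.IsEmb K ∧ G.IsEmb K ∧
    F.i = i ∧ G.i = j ∧ F.j = G.j

/-- The `s`-computable amalgamation property. -/
def CAP (s : Set ℕ) (K : CompAge L) : Prop :=
  ∃ c : OCode, ∀ F₀ F₁ : PotEmb, PotSpan K F₀ F₁ →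
    ∃ G₀ G₁ : PotEmb,
      OCode.eval (chi s) c (Nat.pair F₀.code F₁.code) =
        Part.some (Nat.pair G₀.code G₁.code) ∧
      AmalgDiagOver K F₀ F₁ G₀ G₁

/-- A family `W` of distinguished embeddings with amalgamation-base codomains, closed
under pre/post composition with isomorphisms, covering all domains. -/
def IsCoAPFamily (K : CompAge L) (W : Set PotEmb) : Prop :=
  (∀ F ∈ W, F.Valid K ∧ F.IsEmb K ∧ AmalgBase K.cls (K.str F.j)) ∧
  (∀ F ∈ W, ∀ G H : PotEmb, G.Valid K → G.IsIso K → G.j = F.i →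
      CompRel K F G H → H ∈ W) ∧
  (∀ F ∈ W, ∀ G H : PotEmb, G.Valid K → G.IsIso K → G.i = F.j →
      CompRel K G F H → H ∈ W) ∧
  (∀ i : ℕ, ∃ F ∈ W, F.i = i)

/-- The `s`-computable cofinal amalgamation property: there is an `s`-c.e. family of
distinguished embeddings onto amalgamation bases together with an `s`-computable
amalgamation function. -/
def CcoAP (s : Set ℕ) (K : CompAge L) : Prop :=
  ∃ W : Set PotEmb, IsCoAPFamily K W ∧
    CEIn s { p | ∃ F ∈ W, p = F.code } ∧
    ∃ c : OCode, ∀ F ∈ W, ∀ G₀ G₁ : PotEmb,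
      G₀.Valid K → G₁.Valid K → G₀.i = F.j → G₁.i = F.j →
      ∃ D₀ D₁ : PotEmb,
        OCode.eval (chi s) c (Nat.pair F.code (Nat.pair G₀.code G₁.code)) =
          Part.some (Nat.pair D₀.code D₁.code) ∧
        AmalgDiagOver K G₀ G₁ D₀ D₁

/-! ### Ultrahomogeneity -/

/-- `M` is ultrahomogeneous: every isomorphism between finitely generated substructures
extends to an automorphism. -/
def Ultrahomogeneous (M : Str L) : Prop :=
  ∀ as bs : List ℕ, TupleIn M as → TupleIn M bs → ClSim M as M bs →
    ∃ g : ℕ → ℕ, IsAutoOf M g ∧ as.map g = bs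

/-- `g` is a bijection of the underlying set of `M` with itself. -/
def BijOnDom (M : Str L) (g : ℕ → ℕ) : Prop :=
  (∀ x ∈ M.dom, g x ∈ M.dom) ∧
  (∀ x ∈ M.dom, ∀ y ∈ M.dom, g x = g y → x = y) ∧
  (∀ y ∈ M.dom, ∃ x ∈ M.dom, g x = y)

/-- `M` is `s`-computably ultrahomogeneous. -/
def CompUltrahom (s : Set ℕ) (M : Str L) : Prop :=
  ∃ c : OCode, ∀ as bs : List ℕ, TupleIn M as → TupleIn M bs →
    as.length = bs.length →
    ∃ e : ℕ,
      OCode.eval (chi s) c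
          (Nat.pair (Encodable.encode as) (Encodable.encode bs)) = Part.some e ∧
      ∃ c' : OCode, c'.encodeCode = e ∧ ∃ g : ℕ → ℕ, ComputesIn s c' g ∧
        BijOnDom M g ∧
        (ClSim M as M bs → IsAutoOf M g ∧ as.map g = bs)

/-! ### Cofinal ultrahomogeneity -/

/-- `M` is cofinally ultrahomogeneous. -/
def CofinallyUltrahomogeneous (M : Str L) : Prop :=
  ∀ as : List ℕ, TupleIn M as → ∃ bs : List ℕ, TupleIn M bs ∧
    (∀ x ∈ as, InClosure M bs x) ∧
    ∀ cs : List ℕ, TupleIn M cs → ClSim M bs M cs →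
      ∃ g : ℕ → ℕ, IsAutoOf M g ∧ bs.map g = cs

/-- `E` is a cofinal collection of tuples in `M`. -/
def IsCofinalCollection (M : Str L) (E : Set (List ℕ)) : Prop :=
  (∀ bs ∈ E, TupleIn M bs) ∧
  (∀ as : List ℕ, TupleIn M as → ∃ bs ∈ E, ∀ x ∈ as, InClosure M bs x) ∧
  (∀ bs ∈ E, ∀ as : List ℕ, (∀ x ∈ as, InClosure M bs x) → (as ++ bs) ∈ E) ∧
  (∀ as ∈ E, ∀ bs : List ℕ, TupleIn M bs → ClSim M as M bs → bs ∈ E)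

/-- `M` is cofinally ultrahomogeneous for the collection `E`: every isomorphism between
substructures generated by members of `E` extends to an automorphism. -/
def CofUltraFor (M : Str L) (E : Set (List ℕ)) : Prop :=
  ∀ as ∈ E, ∀ bs ∈ E, ClSim M as M bs →
    ∃ g : ℕ → ℕ, IsAutoOf M g ∧ as.map g = bs

/-- The set of codes of members of `E`. -/
def ECodes (E : Set (List ℕ)) : Set ℕ := { p | ∃ as ∈ E, p = Encodable.encode as }

/-- The functional part of `s`-computable cofinal ultrahomogeneity with respect to `E`. -/
def CofUltraFunIn (s : Set ℕ) (M : Str L) (E : Set (List ℕ)) : Prop :=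
  ∃ c : OCode, ∀ as ∈ E, ∀ bs : List ℕ, TupleIn M bs → TupleSim as bs →
    ∃ e : ℕ,
      OCode.eval (chi s) c
          (Nat.pair (Encodable.encode as) (Encodable.encode bs)) = Part.some e ∧
      ∃ c' : OCode, c'.encodeCode = e ∧ ∃ g : ℕ → ℕ, ComputesIn s c' g ∧
        BijOnDom M g ∧ as.map g = bs ∧
        (ClSim M as M bs → IsAutoOf M g)

/-- `M` is `s`-computably cofinally ultrahomogeneous with respect to `E`. -/
def CompCofUltrahomWrt (s : Set ℕ) (M : Str L) (E : Set (List ℕ)) : Prop :=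
  IsCofinalCollection M E ∧ SetRecIn s (ECodes E) ∧ CofUltraFunIn s M E

/-- `M` is `s`-computably cofinally ultrahomogeneous. -/
def CompCofUltrahom (s : Set ℕ) (M : Str L) : Prop :=
  ∃ E : Set (List ℕ), CompCofUltrahomWrt s M E

/-- The `s`-computable cofinal extension property with respect to `E`. -/
def CompCofExtProp (s : Set ℕ) (M : Str L) (E : Set (List ℕ)) : Prop :=
  ∃ c : OCode, ∀ as bs cs : List ℕ, as ∈ E → cs ∈ E → TupleIn M bs →
    (∀ x ∈ as, InClosure M cs x) → TupleSim as bs →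
    ∃ ds : List ℕ,
      OCode.eval (chi s) c
          (Nat.pair (Encodable.encode as)
            (Nat.pair (Encodable.encode bs) (Encodable.encode cs))) =
        Part.some (Encodable.encode ds) ∧
      TupleIn M ds ∧ TupleSim (as ++ cs) (bs ++ ds) ∧
      (ClSim M as M bs →
        ClSim M ds M cs ∧ (∀ x ∈ bs, InClosure M ds x) ∧
        ∀ h h' : ℕ → ℕ,
          ds.map h = cs → IsIsoMap (M.sub ds) (M.sub cs) h →
          bs.map h' = as → IsIsoMap (M.sub bs) (M.sub as) h' →
          bs.map h = bs.map h')

/-! ### Canonical ages and limits -/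

/-- `K` is a canonical age of `M` (relative to the oracle `t`): the enumeration of
generating tuples is `t`-computable, lists every finite tuple of `M` infinitely often,
and `str i` is the substructure generated by `tup i`. -/
def IsCanonicalAgeOf (t : Set ℕ) (K : CompAge L) (M : Str L) : Prop :=
  TotalComputableIn t (fun i => Encodable.encode (K.tup i)) ∧
  (∀ i, TupleIn M (K.tup i)) ∧
  (∀ as : List ℕ, TupleIn M as → ∀ n : ℕ, ∃ i, n ≤ i ∧ K.tup i = as) ∧
  (∀ i, K.str i = M.sub (K.tup i))

/-- `K` represents the age of `M`. -/
def RepresentsAgeOf (K : CompAge L) (M : Str L) : Prop :=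
  (∀ i, AgeMemOf M (K.str i)) ∧
  (∀ B : Str L, AgeMemOf M B → ∃ i, Isom B (K.str i))

/-- `M` is a cofinal Fraïssé limit of (the age represented by) `K`. -/
def CofinalFraisseLimitOf (K : CompAge L) (M : Str L) : Prop :=
  CofinallyUltrahomogeneous M ∧ RepresentsAgeOf K M

/-- The enumerated age `K` is uniformly finite. -/
def UniformlyFinite (K : CompAge L) : Prop :=
  L.FiniteLang ∧ ∃ f : ℕ → ℕ, TotalComputableIn ∅ f ∧
    ∀ i, ∀ as : List ℕ, TupleIn (K.str i) as →
      { x | InClosure (K.str i) as x }.Finite ∧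
      { x | InClosure (K.str i) as x }.ncard ≤ f as.length


/-! ### A small calculus of functions computable relative to an oracle -/

open Encodable

/-- An ordinary code viewed as an oracle code that never consults its oracle. -/
def OCode.ofCode : Nat.Partrec.Code → OCode
  | .zero => .zero
  | .succ => .succ
  | .left => .left
  | .right => .right
  | .pair a b => .pair (ofCode a) (ofCode b)
  | .comp a b => .comp (ofCode a) (ofCode b)
  | .prec a b => .prec (ofCode a) (ofCode b)
  | .rfind' a => .rfind' (ofCode a)

theorem OCode.eval_ofCode (O : ℕ →. ℕ) (c : Nat.Partrec.Code) :
    (OCode.ofCode c).eval O = c.eval := by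
  induction c with
  | zero => rfl
  | succ => rfl
  | left => rfl
  | right => rfl
  | pair a b iha ihb =>
    simp only [OCode.ofCode, OCode.eval, Nat.Partrec.Code.eval, iha, ihb]
    rfl
  | comp a b iha ihb =>
    simp only [OCode.ofCode, OCode.eval, Nat.Partrec.Code.eval, iha, ihb]
    rfl
  | prec a b iha ihb =>
    simp only [OCode.ofCode, OCode.eval, Nat.Partrec.Code.eval, iha, ihb]
    rfl
  | rfind' a iha =>
    simp only [OCode.ofCode, OCode.eval, Nat.Partrec.Code.eval, iha]
    rfl

theorem OCode.eval_comp {O : ℕ →. ℕ} (c : OCode) {d : OCode} {n m : ℕ}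
    (h : d.eval O n = Part.some m) : (OCode.comp c d).eval O n = c.eval O m := by
  change (d.eval O n).bind (fun k => c.eval O k) = _
  rw [h, Part.bind_some]

section Calculus

variable {α β γ σ : Type*} [Primcodable α] [Primcodable β] [Primcodable γ] [Primcodable σ]
  {s : Set ℕ}

/-- The function `f` between coded types is computed by an oracle code relative to `s`. -/
def CompIn (s : Set ℕ) (f : α → σ) : Prop :=
  ∃ c : OCode, ∀ a, OCode.eval (chi s) c (encode a) = Part.some (encode (f a))

/-- The predicate `p` on a coded type is decidable relative to `s`. -/
def DecIn (s : Set ℕ) (p : α → Prop) : Prop := CompIn s (fun a => decide (p a))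

theorem CompIn.of_primrec {f : α → σ} (hf : Primrec f) : CompIn s f := by
  have h : Nat.Primrec fun n => (encode ((decode (α := α) n).map f)).pred :=
    Nat.Primrec.pred.comp hf
  obtain ⟨c, hc⟩ := Nat.Partrec.Code.exists_code.1 (Nat.Partrec.of_primrec h)
  refine ⟨OCode.ofCode c, fun a => ?_⟩
  rw [OCode.eval_ofCode, hc]
  simp

theorem CompIn.comp {g : β → σ} {f : α → β} (hg : CompIn s g) (hf : CompIn s f) :
    CompIn s (fun a => g (f a)) := by
  obtain ⟨c, hc⟩ := hg
  obtain ⟨d, hd⟩ := hf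
  refine ⟨.comp c d, fun a => ?_⟩
  rw [OCode.eval_comp c (hd a), hc]

theorem CompIn.pair {f : α → β} {g : α → γ} (hf : CompIn s f) (hg : CompIn s g) :
    CompIn s (fun a => (f a, g a)) := by
  obtain ⟨c, hc⟩ := hf
  obtain ⟨d, hd⟩ := hg
  refine ⟨.pair c d, fun a => ?_⟩
  simp [OCode.eval, hd, hc, Seq.seq]

theorem CompIn.nat_rec {f : α → σ} {g : α × ℕ × σ → σ} (hf : CompIn s f) (hg : CompIn s g) :
    CompIn s (fun q : α × ℕ => (Nat.rec (f q.1) (fun n r => g (q.1, n, r)) q.2 : σ)) := by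
  obtain ⟨c, hc⟩ := hf
  obtain ⟨d, hd⟩ := hg
  refine ⟨.prec c d, fun ⟨a, n⟩ => ?_⟩
  induction n with
  | zero => simp [OCode.eval, hc]
  | succ n ih =>
    have hda := hd (a, n, Nat.rec (f a) (fun n r => g (a, n, r)) n)
    simp only [OCode.eval, encode_prod_val, Nat.unpaired, Nat.unpair_pair, encode_nat] at ih hda ⊢
    rw [ih]
    simp [hda]

theorem CompIn.ite {p : α → Prop} {f g : α → σ} (hp : DecIn s p) (hf : CompIn s f)
    (hg : CompIn s g) : CompIn s (fun a => if p a then f a else g a) := by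
  have h : Primrec fun q : Bool × σ × σ => bif q.1 then q.2.1 else q.2.2 :=
    Primrec.cond .fst (Primrec.fst.comp .snd) (Primrec.snd.comp .snd)
  have := (CompIn.of_primrec (s := s) h).comp (hp.pair (hf.pair hg))
  convert this using 2 with a
  by_cases h : p a <;> simp [h]

theorem DecIn.of_primrecPred {p : α → Prop} (hp : PrimrecPred p) : DecIn s p := by
  obtain ⟨_, h⟩ := hp
  refine CompIn.of_primrec (h.of_eq fun a => ?_)
  by_cases h : p a <;> simp [h]

theorem DecIn.comp {p : β → Prop} {f : α → β} (hp : DecIn s p) (hf : CompIn s f) :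
    DecIn s (fun a => p (f a)) :=
  CompIn.comp hp hf

theorem DecIn.of_iff {p q : α → Prop} (hp : DecIn s p) (h : ∀ a, p a ↔ q a) : DecIn s q := by
  have : p = q := funext fun a => propext (h a)
  exact this ▸ hp

theorem DecIn.imp {p q : α → Prop} (hp : DecIn s p) (hq : DecIn s q) :
    DecIn s (fun a => p a → q a) := by
  have h : Primrec fun x : Bool × Bool => !x.1 || x.2 := Primrec.dom_finite _
  have := (CompIn.of_primrec (s := s) h).comp (hp.pair hq)
  unfold DecIn
  convert this using 2 with a
  by_cases h : p a <;> simp [h]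

theorem DecIn.and {p q : α → Prop} (hp : DecIn s p) (hq : DecIn s q) :
    DecIn s (fun a => p a ∧ q a) := by
  have h : Primrec fun x : Bool × Bool => x.1 && x.2 := Primrec.dom_finite _
  have := (CompIn.of_primrec (s := s) h).comp (hp.pair hq)
  unfold DecIn
  convert this using 2 with a
  simp

theorem DecIn.not {p : α → Prop} (hp : DecIn s p) : DecIn s (fun a => ¬ p a) := by
  have := (CompIn.of_primrec (s := s) Primrec.not).comp hp
  unfold DecIn
  convert this using 2 with a
  simp

theorem DecIn.of_setRecIn {A : Set ℕ} (h : SetRecIn s A) : DecIn s (fun n => n ∈ A) := by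
  obtain ⟨c, hc⟩ := h
  refine ⟨c, fun n => ?_⟩
  rw [hc]
  by_cases h : n ∈ A <;> simp [chi, h]

theorem CompIn.exists_nat_search {p : α → ℕ → Prop} (hp : DecIn s (fun q : α × ℕ => p q.1 q.2))
    (h : ∀ a, ∃ n, p a n) : ∃ f : α → ℕ, CompIn s f ∧ ∀ a, p a (f a) := by
  obtain ⟨c, hc⟩ := hp.not
  refine ⟨fun a => Nat.find (h a), ⟨.comp (.rfind' c)
    (.pair (.pair .left .right) .zero), fun a => ?_⟩, fun a => Nat.find_spec (h a)⟩
  have hc' : ∀ n, OCode.eval (chi s) c (Nat.pair (encode a) n) =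
      Part.some (encode (decide (¬ p a n))) := fun n => by simpa using hc (a, n)
  let P : ℕ →. Bool := fun n => Part.some (decide (p a n))
  have hP : (fun n => (fun m => decide (m = 0)) <$> OCode.eval (chi s) c
      (Nat.pair (encode a) (n + 0)) : ℕ →. Bool) = P := by
    funext n
    rw [Nat.add_zero, hc']
    by_cases hn : p a n <;> simp [P, hn]
  have hr : OCode.eval (chi s) (.rfind' c) (Nat.pair (encode a) 0) = Nat.rfind P := by
    simp only [OCode.eval, Nat.unpaired, Nat.unpair_pair]
    rw [hP]
    exact Part.map_id' (fun _ => rfl) _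
  have hq : OCode.eval (chi s) (.pair (.pair .left .right) .zero) (encode a) =
      Part.some (Nat.pair (encode a) 0) := by
    simp [OCode.eval, Seq.seq, pure, PFun.pure]
  rw [OCode.eval_comp _ hq, hr, Part.eq_some_iff, Nat.mem_rfind]
  refine ⟨by simpa [P] using Nat.find_spec (h a), fun {m} hm => ?_⟩
  simpa [P] using Nat.find_min (h a) hm

theorem CompIn.exists_search [Inhabited β] {p : α → β → Prop}
    (hp : DecIn s (fun q : α × β => p q.1 q.2)) (h : ∀ a, ∃ b, p a b) :
    ∃ f : α → β, CompIn s f ∧ ∀ a, p a (f a) := by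
  have hd : Primrec fun n : ℕ => ((decode n : Option β).getD default) :=
    Primrec.option_getD.comp Primrec.decode (Primrec.const default)
  obtain ⟨f, hf, hpf⟩ := CompIn.exists_nat_search
    (p := fun a n => p a ((decode n : Option β).getD default))
    (hp.comp (CompIn.pair (CompIn.of_primrec Primrec.fst)
      (CompIn.of_primrec (hd.comp Primrec.snd))))
    (fun a => (h a).imp' encode fun b hb => by simpa using hb)
  exact ⟨_, (CompIn.of_primrec hd).comp hf, hpf⟩

/-- The code computing the constant function with value `n`. -/
def OCode.const : ℕ → OCode
  | 0 => .zero
  | n + 1 => .comp .succ (const n)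

theorem OCode.eval_const (O : ℕ →. ℕ) (n m : ℕ) : (OCode.const n).eval O m = Part.some n := by
  induction n with
  | zero => rfl
  | succ n ih =>
    rw [OCode.const, OCode.eval_comp _ ih]
    rfl

theorem OCode.primrec_encodeCode_const : Primrec fun n => (OCode.const n).encodeCode := by
  have h : Primrec₂ fun (_ r : ℕ) => 4 * Nat.pair 1 r + 6 :=
    Primrec.nat_add.comp₂ (Primrec.nat_mul.comp₂ (Primrec.const 4).to₂
      (Primrec₂.natPair.comp₂ (Primrec.const 1).to₂ Primrec₂.right)) (Primrec.const 6).to₂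
  refine (Primrec.nat_rec₁ 0 h).of_eq fun n => ?_
  induction n with
  | zero => rfl
  | succ n ih => simp [OCode.const, OCode.encodeCode, ← ih]

/-- Parametrization: an index of a section of a computable function of two variables can be
computed from the parameter. -/
theorem CompIn.exists_index {f : α × ℕ → ℕ} (hf : CompIn s f) :
    ∃ e : α → ℕ, CompIn s e ∧
      ∀ a, ∃ c : OCode, c.encodeCode = e a ∧ ComputesIn s c (fun n => f (a, n)) := by
  obtain ⟨c, hc⟩ := hf
  let d : α → OCode := fun a =>
    .comp c (.pair (.const (encode a)) (.pair .left .right))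
  refine ⟨fun a => (d a).encodeCode, CompIn.of_primrec ?_, fun a => ⟨d a, rfl, fun n => ?_⟩⟩
  · simp only [d, OCode.encodeCode]
    have h := OCode.primrec_encodeCode_const.comp (Primrec.encode (α := α))
    exact Primrec.nat_add.comp (Primrec.nat_mul.comp (.const 4) (Primrec₂.natPair.comp (.const _)
      (Primrec.nat_add.comp (Primrec.nat_mul.comp (.const 4)
        (Primrec₂.natPair.comp h (.const _))) (.const 5)))) (.const 6)
  · have := hc (a, n)
    simp only [encode_prod_val, encode_nat] at this
    have hq : OCode.eval (chi s) (.pair (.const (encode a)) (.pair .left .right)) n =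
        Part.some (Nat.pair (encode a) n) := by
      simp [OCode.eval, Seq.seq, OCode.eval_const]
    rw [OCode.eval_comp _ hq, this]

end Calculus

/-! ### Generated substructures and tuple equivalences -/

theorem InClosure.trans {M : Str L} {a b : List ℕ} (hab : ∀ x ∈ a, InClosure M b x) {x : ℕ}
    (hx : InClosure M a x) : InClosure M b x := by
  induction hx with
  | base hx _ => exact hab _ hx
  | fn f as hf _ ih => exact .fn f as hf ih

theorem inClosure_self {M : Str L} {a : List ℕ} (ha : TupleIn M a) :
    ∀ x ∈ a, InClosure M a x :=
  fun x hx => .base hx (ha x hx)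

theorem inClosure_sub_iff {M : Str L} {S a : List ℕ} (ha : ∀ x ∈ a, InClosure M S x) {x : ℕ} :
    InClosure (M.sub S) a x ↔ InClosure M a x := by
  constructor <;> intro h
  · induction h with
    | base hx hd => exact .base hx (InClosure.mem_dom hd)
    | fn f as hf _ ih => exact InClosure.fn (A := M) f as hf ih
  · induction h with
    | base hx hd => exact .base hx (ha _ hx)
    | fn f as hf _ ih => exact InClosure.fn (A := M.sub S) f as hf ih

theorem Str.sub_sub {M : Str L} {S a : List ℕ} (ha : ∀ x ∈ a, InClosure M S x) :
    (M.sub S).sub a = M.sub a := by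
  have hd : {x | InClosure (M.sub S) a x} = {x | InClosure M a x} :=
    Set.ext fun _ => inClosure_sub_iff ha
  have hr : (fun r as => (M.sub S).rel r as ∧ ∀ x ∈ as, InClosure (M.sub S) a x) =
      fun r as => M.rel r as ∧ ∀ x ∈ as, InClosure M a x := by
    funext r as
    simp only [inClosure_sub_iff ha, eq_iff_iff]
    exact ⟨fun h => ⟨h.1.1, h.2⟩, fun h => ⟨⟨h.1, fun x hx => (h.2 x hx).trans ha⟩, h.2⟩⟩
  unfold Str.sub at *
  congr

theorem IsEmbMap.inClosure_map {A B : Str L} {h : ℕ → ℕ} (hh : IsEmbMap A B h) {a : List ℕ}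
    {x : ℕ} (hx : InClosure A a x) : InClosure B (a.map h) (h x) := by
  induction hx with
  | base hx hd => exact .base (List.mem_map_of_mem hx) (hh.1 _ hd)
  | fn f as hf has ih =>
    rw [hh.2.2.2 f as hf fun x hx => (has x hx).mem_dom]
    refine .fn f _ (by simpa using hf) fun y hy => ?_
    obtain ⟨x, hx, rfl⟩ := List.mem_map.1 hy
    exact ih x hx

theorem exists_map_eq_of_forall_mem {p : ℕ → Prop} {h : ℕ → ℕ} :
    ∀ {l : List ℕ}, (∀ y ∈ l, ∃ x, p x ∧ h x = y) → ∃ k : List ℕ, (∀ x ∈ k, p x) ∧ k.map h = l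
  | [], _ => ⟨[], by simp⟩
  | y :: l, H => by
    obtain ⟨x, hx, rfl⟩ := H y (by simp)
    obtain ⟨k, hk, rfl⟩ := exists_map_eq_of_forall_mem (l := l) fun z hz => H z (by simp [hz])
    exact ⟨x :: k, by simpa [hx] using hk, rfl⟩

theorem IsEmbMap.isIsoMap_sub {A B : Str L} {h : ℕ → ℕ} (hh : IsEmbMap A B h) {a : List ℕ}
    (ha : TupleIn A a) : IsIsoMap (A.sub a) (B.sub (a.map h)) h := by
  refine ⟨⟨fun x hx => hh.inClosure_map hx, fun x hx y hy => hh.2.1 x hx.mem_dom y hy.mem_dom,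
    fun r as has => ?_, fun f as hf has => hh.2.2.2 f as hf fun x hx => (has x hx).mem_dom⟩, ?_⟩
  · have h1 := hh.2.2.1 r as fun x hx => (has x hx).mem_dom
    refine ⟨fun H => ⟨h1.1 H.1, fun y hy => ?_⟩, fun H => ⟨h1.2 H.1, has⟩⟩
    obtain ⟨x, hx, rfl⟩ := List.mem_map.1 hy
    exact hh.inClosure_map (has x hx)
  · intro y hy
    change InClosure B (a.map h) y at hy
    change ∃ x, InClosure A a x ∧ h x = y
    induction hy with
    | base hy _ =>
      obtain ⟨x, hx, rfl⟩ := List.mem_map.1 hy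
      exact ⟨x, .base hx (ha x hx), rfl⟩
    | fn f as hf _ ih =>
      obtain ⟨k, hk, rfl⟩ := exists_map_eq_of_forall_mem ih
      have hf' : L.funArity f = some k.length := by simpa using hf
      exact ⟨A.fn f k, .fn f k hf' hk,
        hh.2.2.2 f k hf' fun x hx => (hk x hx).mem_dom⟩

theorem IsEmbMap.isIsoMap_sub_sub {M N : Str L} {S T a : List ℕ} {h : ℕ → ℕ}
    (hh : IsEmbMap (M.sub S) (N.sub T) h) (ha : ∀ x ∈ a, InClosure M S x) :
    IsIsoMap (M.sub a) (N.sub (a.map h)) h := by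
  have h1 := hh.isIsoMap_sub (a := a) ha
  have h2 : ∀ y ∈ a.map h, InClosure N T y := by
    intro y hy
    obtain ⟨x, hx, rfl⟩ := List.mem_map.1 hy
    exact hh.1 x (ha x hx)
  rwa [Str.sub_sub ha, Str.sub_sub h2] at h1

theorem IsEmbMap.eq_of_inClosure {A B : Str L} {S : List ℕ} {h k : ℕ → ℕ}
    (hh : IsEmbMap (A.sub S) B h) (hk : IsEmbMap (A.sub S) B k)
    (hS : ∀ x ∈ S, h x = k x) {x : ℕ} (hx : InClosure A S x) : h x = k x := by
  induction hx with
  | base hx _ => exact hS _ hx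
  | fn f as hf has ih =>
    exact (hh.2.2.2 f as hf has).trans
      ((congrArg _ (List.map_congr_left ih)).trans (hk.2.2.2 f as hf has).symm)

theorem IsIsoMap.exists_inverse {A B : Str L} {h : ℕ → ℕ} (hh : IsIsoMap A B h) :
    ∃ k, IsIsoMap B A k ∧ ∀ x ∈ A.dom, k (h x) = x := by
  obtain ⟨⟨hmem, hinj, hrel, hfn⟩, hsurj⟩ := hh
  choose! k hk hhk using hsurj
  have hkh : ∀ x ∈ A.dom, k (h x) = x := fun x hx =>
    hinj _ (hk _ (hmem x hx)) _ hx (hhk _ (hmem x hx))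
  have hmap : ∀ as, TupleIn B as → TupleIn A (as.map k) ∧ (as.map k).map h = as := by
    intro as has
    refine ⟨fun y hy => ?_, ?_⟩
    · obtain ⟨x, hx, rfl⟩ := List.mem_map.1 hy
      exact hk x (has x hx)
    · rw [List.map_map]
      exact (List.map_congr_left fun x hx => hhk x (has x hx)).trans (List.map_id _)
  refine ⟨k, ⟨⟨hk, fun x hx y hy hxy => ?_, fun r as has => ?_, fun f as hf has => ?_⟩,
    fun x hx => ⟨h x, hmem x hx, hkh x hx⟩⟩, hkh⟩
  · rw [← hhk x hx, hxy, hhk y hy]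
  · rw [hrel r _ (hmap as has).1, (hmap as has).2]
  · have hf' : L.funArity f = some (as.map k).length := by simpa using hf
    have := hfn f _ hf' (hmap as has).1
    rw [(hmap as has).2] at this
    rw [← this, hkh _ (A.fn_mem f _ hf' (hmap as has).1)]

theorem ClSim.tupleIn {M N : Str L} {as bs : List ℕ} (h : ClSim M as N bs)
    (ha : TupleIn M as) : TupleIn N bs := by
  obtain ⟨h, rfl, hh⟩ := h
  intro y hy
  obtain ⟨x, hx, rfl⟩ := List.mem_map.1 hy
  exact InClosure.mem_dom (hh.1.1 x (inClosure_self ha x hx))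

theorem ClSim.symm {M N : Str L} {as bs : List ℕ} (h : ClSim M as N bs)
    (ha : TupleIn M as) : ClSim N bs M as := by
  obtain ⟨h, rfl, hh⟩ := h
  obtain ⟨k, hk, hkh⟩ := hh.exists_inverse
  refine ⟨k, ?_, hk⟩
  rw [List.map_map]
  exact (List.map_congr_left fun x hx => hkh x (inClosure_self ha x hx)).trans (List.map_id _)

theorem TupleSim.length_eq {as bs : List ℕ} (h : TupleSim as bs) : as.length = bs.length := by
  obtain ⟨h, _, rfl, _⟩ := h
  simp

theorem ClSim.tupleSim {M N : Str L} {as bs : List ℕ} (h : ClSim M as N bs)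
    (ha : TupleIn M as) : TupleSim as bs := by
  obtain ⟨k, hk, -⟩ := h.symm ha
  obtain ⟨h, hh, -⟩ := h
  exact ⟨h, k, hh, hk⟩

theorem tupleSim_map {as : List ℕ} {g : ℕ → ℕ} {D : Set ℕ} (has : ∀ x ∈ as, x ∈ D)
    (hg : ∀ x ∈ D, ∀ y ∈ D, g x = g y → x = y) : TupleSim as (as.map g) := by
  have hinj : Set.InjOn g D := fun x hx y hy => hg x hx y hy
  refine ⟨g, Function.invFunOn g D, rfl, ?_⟩
  rw [List.map_map]
  exact (List.map_congr_left fun x hx => hinj.leftInvOn_invFunOn (has x hx)).trans (List.map_id _)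

theorem IsAutoOf.clSim {M : Str L} {g : ℕ → ℕ} (hg : IsAutoOf M g) {as : List ℕ}
    (ha : TupleIn M as) : ClSim M as M (as.map g) :=
  ⟨g, rfl, hg.1.isIsoMap_sub ha⟩

/-- A pattern-preserving matching of two tuples extends to a bijection of the domain. -/
theorem TupleSim.exists_bijOnDom {M : Str L} {as bs : List ℕ} (h : TupleSim as bs)
    (ha : TupleIn M as) (hb : TupleIn M bs) : ∃ g, BijOnDom M g ∧ as.map g = bs := by
  obtain ⟨h, h', rfl, h2⟩ := h
  rw [List.map_map] at h2
  have hk : ∀ x ∈ as, h' (h x) = x := by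
    have := h2.trans (List.map_id as).symm
    simpa using List.map_inj_left.1 this
  have hbm : ∀ x ∈ as, h x ∈ M.dom := fun x hx => hb _ (List.mem_map_of_mem hx)
  let l := as.dedup
  have hl : ∀ i : Fin l.length, l.get i ∈ as := fun i => List.mem_dedup.1 (List.get_mem l i)
  have hnd : Function.Injective l.get := List.nodup_iff_injective_get.1 (List.nodup_dedup as)
  let x : Fin l.length ↪ M.dom := ⟨fun i => ⟨l.get i, ha _ (hl i)⟩, fun i j hij =>
    hnd (congrArg Subtype.val hij)⟩
  let y : Fin l.length ↪ M.dom := ⟨fun i => ⟨h (l.get i), hbm _ (hl i)⟩, fun i j hij => by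
    have : h (l.get i) = h (l.get j) := congrArg Subtype.val hij
    apply hnd
    rw [← hk _ (hl i), this, hk _ (hl j)]⟩
  obtain ⟨π, hπ⟩ := (Equiv.Perm.isMultiplyPretransitive M.dom l.length).exists_smul_eq x y
  refine ⟨fun n => if hn : n ∈ M.dom then π ⟨n, hn⟩ else n,
    ⟨fun n hn => ?_, fun m hm n hn hmn => ?_,
    fun n hn => ⟨π.symm ⟨n, hn⟩, Subtype.coe_prop _, by simp⟩⟩, ?_⟩
  · simp [hn]
  · simpa [hm, hn, Subtype.val_inj] using hmn
  · refine List.map_congr_left fun n hn => ?_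
    obtain ⟨i, hi⟩ := List.get_of_mem (List.mem_dedup.2 hn : n ∈ l)
    have h1 : (π (x i) : ℕ) = (y i : ℕ) := by rw [← hπ]; rfl
    subst hi
    exact (dif_pos (ha _ (hl i))).trans h1

/-! ### Back and forth -/

/-- The union map of an increasing sequence of finite tuple matchings. -/
theorem exists_map_of_prefix_chain {A B : ℕ → List ℕ} (hAB : ∀ n, TupleSim (A n) (B n))
    (hA : ∀ n, A n <+: A (n + 1)) (hB : ∀ n, B n <+: B (n + 1))
    (hcov : ∀ n, ∀ x ∈ A n, x ∈ A (x + 1)) (n : ℕ) :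
    (A n).map (fun x => (B (x + 1)).getD ((A (x + 1)).idxOf x) 0) = B n := by
  have hmono : ∀ {C : ℕ → List ℕ}, (∀ n, C n <+: C (n + 1)) → ∀ m n, m ≤ n → C m <+: C n := by
    intro C hC m n hmn
    induction hmn with
    | refl => exact List.prefix_rfl
    | step _ ih => exact ih.trans (hC _)
  choose h _ hh _ using hAB
  have hsub : ∀ m n, m ≤ n → (A m).map (h n) = B m := by
    intro m n hmn
    have h1 := (hmono hA m n hmn).map (h n)
    rw [hh n] at h1
    refine (List.prefix_of_prefix_length_le h1 (hmono hB m n hmn) ?_).eq_of_length ?_ <;>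
    · rw [← hh m]
      simp
  have hag : ∀ m n, m ≤ n → ∀ x ∈ A m, h m x = h n x := fun m n hmn =>
    List.map_inj_left.1 ((hh m).trans (hsub m n hmn).symm)
  have hval : ∀ x ∈ A (x + 1), (B (x + 1)).getD ((A (x + 1)).idxOf x) 0 = h (x + 1) x := by
    intro x hx
    have hi := List.idxOf_lt_length_of_mem hx
    rw [← hh (x + 1), List.getD_eq_getElem _ _ (by simpa using hi), List.getElem_map,
      List.getElem_idxOf]
  rw [← hh n]
  refine List.map_congr_left fun x hx => ?_
  have hx' := hcov n x hx
  rw [hval x hx', hag (x + 1) _ (le_max_left _ n) x hx', hag n _ (le_max_right (x + 1) n) x hx]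

theorem bijOnDom_of_chain {M : Str L} {A B : ℕ → List ℕ} {g : ℕ → ℕ}
    (hAM : ∀ n, TupleIn M (A n)) (hBM : ∀ n, TupleIn M (B n)) (hAB : ∀ n, TupleSim (A n) (B n))
    (hg : ∀ n, (A n).map g = B n) (hcov : ∀ l, TupleIn M l → ∃ n, ∀ x ∈ l, x ∈ A n)
    (hcov' : ∀ y ∈ M.dom, ∃ n, y ∈ B n) : BijOnDom M g := by
  refine ⟨fun x hx => ?_, fun x hx y hy hxy => ?_, fun y hy => ?_⟩
  · obtain ⟨n, hn⟩ := hcov [x] (by simpa [TupleIn] using hx)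
    refine hBM n _ ?_
    rw [← hg n]
    exact List.mem_map_of_mem (hn x (by simp))
  · obtain ⟨n, hn⟩ := hcov [x, y] (by simpa [TupleIn] using ⟨hx, hy⟩)
    obtain ⟨_, h', -, h2⟩ := hAB n
    rw [← hg n, List.map_map] at h2
    have := List.map_inj_left.1 (h2.trans (List.map_id _).symm)
    have h3 := this x (hn x (by simp))
    have h4 := this y (hn y (by simp))
    simp only [Function.comp, id] at h3 h4
    rw [← h3, hxy, h4]
  · obtain ⟨n, hn⟩ := hcov' y hy
    rw [← hg n] at hn
    obtain ⟨x, hx, rfl⟩ := List.mem_map.1 hn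
    exact ⟨x, hAM n x hx, rfl⟩

theorem isAutoOf_of_chain {M : Str L} {A B : ℕ → List ℕ} {g : ℕ → ℕ} (hbij : BijOnDom M g)
    (hAM : ∀ n, TupleIn M (A n)) (hAB : ∀ n, ClSim M (A n) M (B n))
    (hg : ∀ n, (A n).map g = B n) (hcov : ∀ l, TupleIn M l → ∃ n, ∀ x ∈ l, x ∈ A n) :
    IsAutoOf M g := by
  have key : ∀ l, TupleIn M l → ∃ n h, IsIsoMap (M.sub (A n)) (M.sub (B n)) h ∧
      (∀ x ∈ l, InClosure M (A n) x ∧ h x = g x) := by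
    intro l hl
    obtain ⟨n, hn⟩ := hcov l hl
    obtain ⟨h, hh, hiso⟩ := hAB n
    have := List.map_inj_left.1 (hh.trans (hg n).symm)
    exact ⟨n, h, hiso, fun x hx => ⟨inClosure_self (hAM n) x (hn x hx), this x (hn x hx)⟩⟩
  refine ⟨⟨hbij.1, hbij.2.1, fun r as has => ?_, fun f as hf has => ?_⟩, hbij.2.2⟩
  · obtain ⟨n, h, hiso, hl⟩ := key as has
    have h1 := hiso.1.2.2.1 r as fun x hx => (hl x hx).1
    rw [List.map_congr_left fun x hx => (hl x hx).2] at h1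
    refine ⟨fun H => (h1.1 ⟨H, fun x hx => (hl x hx).1⟩).1, fun H => (h1.2 ⟨H, fun y hy => ?_⟩).1⟩
    obtain ⟨x, hx, rfl⟩ := List.mem_map.1 hy
    rw [← (hl x hx).2]
    exact hiso.1.1 x (hl x hx).1
  · obtain ⟨n, h, hiso, hl⟩ := key (M.fn f as :: as) fun x hx => by
      rcases List.mem_cons.1 hx with rfl | hx
      exacts [M.fn_mem f as hf has, has x hx]
    have h1 := hiso.1.2.2.2 f as hf fun x hx => (hl x (List.mem_cons_of_mem _ hx)).1
    rw [List.map_congr_left fun x hx => (hl x (List.mem_cons_of_mem _ hx)).2] at h1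
    rw [← (hl (M.fn f as) (by simp)).2]
    exact h1

/-- The extension property lets every matching of a tuple in `E` be prolonged so that its left
side contains a prescribed tuple. -/
theorem CompCofExtProp.exists_forth {s : Set ℕ} {M : Str L} {E : Set (List ℕ)}
    (hE : IsCofinalCollection M E) (hP : CompCofExtProp s M E) {as bs xs : List ℕ}
    (ha : as ∈ E) (hab : ClSim M as M bs) (hxs : TupleIn M xs) :
    ∃ u v, (∀ x ∈ xs, x ∈ u) ∧ as ++ u ∈ E ∧ ClSim M (as ++ u) M (bs ++ v) := by
  have haM := hE.1 as ha
  obtain ⟨t, htE, ht⟩ := hE.2.1 (as ++ xs) fun x hx =>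
    (List.mem_append.1 hx).elim (haM x) (hxs x)
  have hcE := hE.2.2.1 t htE (as ++ xs) ht
  have hcM := hE.1 _ hcE
  obtain ⟨c, hc⟩ := hP
  obtain ⟨ds, -, hdM, -, hd⟩ := hc as bs _ ha hcE (hab.tupleIn haM)
    (fun x hx => inClosure_self hcM x (by simp [hx])) (hab.tupleSim haM)
  obtain ⟨hdc, hbd, hagree⟩ := hd hab
  obtain ⟨h', hh', hiso'⟩ := hab.symm haM
  obtain ⟨h, hh, hiso⟩ := id hdc
  have hbh : bs.map h = as := (hagree h h' hh hiso hh' hiso').trans hh'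
  obtain ⟨k, -, hk⟩ := hiso.exists_inverse
  have hinj : ∀ l : List ℕ, (∀ x ∈ l, InClosure M ds x) → (l.map h).map k = l := by
    intro l hl
    rw [List.map_map]
    exact (List.map_congr_left fun x hx => hk x (hl x hx)).trans (List.map_id _)
  have htake : ds.take as.length = bs := by
    rw [← hinj _ fun x hx => inClosure_self hdM x (List.mem_of_mem_take hx), List.map_take, hh,
      List.append_assoc, List.take_left, ← hbh, hinj bs hbd]
  refine ⟨xs ++ t, ds.drop as.length, fun x hx => by simp [hx], by simpa using hcE, ?_⟩
  have := hdc.symm hdM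
  rw [← htake, List.take_append_drop]
  simpa using this

theorem CompCofExtProp.exists_back_and_forth {s : Set ℕ} {M : Str L} {E : Set (List ℕ)}
    (hE : IsCofinalCollection M E) (hP : CompCofExtProp s M E) {as bs xs : List ℕ}
    (ha : as ∈ E) (hab : ClSim M as M bs) (hxs : TupleIn M xs) :
    ∃ u v, (∀ x ∈ xs, x ∈ u ∧ x ∈ v) ∧ as ++ u ∈ E ∧ ClSim M (as ++ u) M (bs ++ v) := by
  obtain ⟨u, v, hu, hE1, h1⟩ := hP.exists_forth hE ha hab hxs
  have hM1 := hE.1 _ hE1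
  have hE2 := hE.2.2.2 _ hE1 _ (h1.tupleIn hM1) h1
  obtain ⟨v', u', hv, hE3, h2⟩ := hP.exists_forth hE hE2 (h1.symm hM1) hxs
  have hM3 := hE.1 _ hE3
  have hE4 := hE.2.2.2 _ hE3 _ (h2.tupleIn hM3) h2
  have h3 := h2.symm hM3
  rw [List.append_assoc] at hE4
  rw [List.append_assoc, List.append_assoc] at h3
  exact ⟨u ++ u', v ++ v', fun x hx => by simp [hu x hx, hv x hx], hE4, h3⟩

/-- The state `q` is a legitimate stage of a back-and-forth construction started at `p`. -/
def BackForthState (M : Str L) (E : Set (List ℕ)) (p q : List ℕ × List ℕ) : Prop :=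
  TupleIn M q.1 ∧ TupleIn M q.2 ∧ TupleSim q.1 q.2 ∧
    (ClSim M p.1 M p.2 → q.1 ∈ E ∧ ClSim M q.1 M q.2)

theorem BackForthState.exists_next {s : Set ℕ} {M : Str L} {E : Set (List ℕ)}
    (hE : IsCofinalCollection M E) (hP : CompCofExtProp s M E) {p q : List ℕ × List ℕ}
    (hq : BackForthState M E p q) (n : ℕ) :
    ∃ w : List ℕ × List ℕ, BackForthState M E p (q.1 ++ w.1, q.2 ++ w.2) ∧
      (n ∈ M.dom → n ∈ q.1 ++ w.1 ∧ n ∈ q.2 ++ w.2) := by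
  obtain ⟨hA, hB, hAB, hcl⟩ := hq
  let xs : List ℕ := if n ∈ M.dom then [n] else []
  have hxs : TupleIn M xs := by
    intro x hx
    by_cases hn : n ∈ M.dom <;> simp [xs, hn] at hx
    exact hx ▸ hn
  have hnx : n ∈ M.dom → n ∈ xs := fun hn => by simp [xs, hn]
  by_cases hp : ClSim M p.1 M p.2
  · obtain ⟨u, v, hc, hE1, h1⟩ := hP.exists_back_and_forth hE (hcl hp).1 (hcl hp).2 hxs
    have hM := hE.1 _ hE1
    refine ⟨(u, v), ⟨hM, h1.tupleIn hM, h1.tupleSim hM, fun _ => ⟨hE1, h1⟩⟩, fun hn => ?_⟩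
    simp [hc n (hnx hn)]
  · obtain ⟨g, hg, hgm⟩ := hAB.exists_bijOnDom hA hB
    obtain ⟨ys, hys, hyx⟩ := exists_map_eq_of_forall_mem fun y hy => hg.2.2 y (hxs y hy)
    have hM : TupleIn M (q.1 ++ (xs ++ ys)) := by
      intro x hx
      simp only [List.mem_append] at hx
      rcases hx with hx | hx | hx
      exacts [hA x hx, hxs x hx, hys x hx]
    have hmap : (q.1 ++ (xs ++ ys)).map g = q.2 ++ (xs ++ ys).map g := by
      rw [List.map_append, hgm]
    refine ⟨(xs ++ ys, (xs ++ ys).map g), ⟨hM, ?_, ?_, fun h => (hp h).elim⟩, fun hn => ?_⟩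
    · change TupleIn M (q.2 ++ (xs ++ ys).map g)
      rw [← hmap]
      intro y hy
      obtain ⟨x, hx, rfl⟩ := List.mem_map.1 hy
      exact hg.1 x (hM x hx)
    · change TupleSim _ (q.2 ++ (xs ++ ys).map g)
      rw [← hmap]
      exact tupleSim_map hM hg.2.1
    · simp only [List.map_append, hyx, List.mem_append]
      exact ⟨.inr (.inl (hnx hn)), .inr (.inr (hnx hn))⟩

/-! ### Decidability of the relevant relations -/

theorem DecIn.forall_lt {α : Type*} [Primcodable α] {s : Set ℕ} {p : α → ℕ → Prop}
    (hp : DecIn s (fun q : α × ℕ => p q.1 q.2)) :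
    DecIn s (fun q : α × ℕ => ∀ m < q.2, p q.1 m) := by
  have hstep : DecIn s (fun q : α × ℕ × Bool => q.2.2 = true ∧ p q.1 q.2.1) :=
    (DecIn.of_primrecPred (Primrec.eq.comp (Primrec.snd.comp .snd) (.const true))).and
      (hp.comp (CompIn.of_primrec (Primrec.pair .fst (Primrec.fst.comp .snd))))
  have h := CompIn.nat_rec (f := fun _ : α => true) (CompIn.of_primrec (.const true)) hstep
  unfold DecIn
  convert h using 2 with q
  obtain ⟨a, n⟩ := q
  induction n with
  | zero => simp
  | succ n ih =>
    simp only at ih ⊢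
    rw [← ih]
    exact decide_eq_decide.2
      (Nat.forall_lt_succ_right.trans (and_congr_left' (@decide_eq_true_iff _ (_)).symm))

theorem DecIn.tupleIn {s : Set ℕ} {M : Str L} (hM : StrComputableIn s M) :
    DecIn s (TupleIn M) := by
  have h1 : DecIn s (fun q : List ℕ × ℕ => q.1.getD q.2 0 ∈ M.dom) :=
    (DecIn.of_setRecIn hM.1).comp (CompIn.of_primrec (Primrec.list_getD 0))
  have h2 := (DecIn.forall_lt (p := fun l n => l.getD n 0 ∈ M.dom) h1).comp
    (CompIn.of_primrec (Primrec.pair .id (Primrec.list_length (α := ℕ))))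
  refine h2.of_iff fun l => ?_
  simp only [id, TupleIn, List.forall_mem_iff_getElem]
  exact forall₂_congr fun n hn => by rw [List.getD_eq_getElem _ _ hn]

theorem DecIn.mem_of_eCodes {s : Set ℕ} {E : Set (List ℕ)} (hE : SetRecIn s (ECodes E)) :
    DecIn s (fun as => as ∈ E) := by
  refine ((DecIn.of_setRecIn hE).comp (CompIn.of_primrec Primrec.encode)).of_iff fun as => ?_
  refine ⟨?_, fun h => ⟨as, h, rfl⟩⟩
  rintro ⟨bs, hbs, hab⟩
  exact encode_injective hab ▸ hbs

theorem tupleSim_iff_lookup {as bs : List ℕ} :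
    TupleSim as bs ↔ as.map (fun x => bs.getD (as.idxOf x) 0) = bs ∧
      bs.map (fun x => as.getD (bs.idxOf x) 0) = as := by
  have key : ∀ {as bs : List ℕ} {h : ℕ → ℕ}, as.map h = bs →
      as.map (fun x => bs.getD (as.idxOf x) 0) = bs := by
    rintro as _ h rfl
    refine List.map_congr_left fun x hx => ?_
    have hi := List.idxOf_lt_length_of_mem hx
    rw [List.getD_eq_getElem _ _ (by simpa using hi), List.getElem_map, List.getElem_idxOf]
  exact ⟨fun ⟨_, _, h1, h2⟩ => ⟨key h1, key h2⟩, fun h => ⟨_, _, h.1, h.2⟩⟩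

theorem PrimrecPred.tupleSim :
    PrimrecPred (fun q : List ℕ × List ℕ => TupleSim q.1 q.2) := by
  have hl : Primrec fun q : List ℕ × List ℕ => q.1.map fun x => q.2.getD (q.1.idxOf x) 0 :=
    Primrec.list_map .fst (Primrec.to₂ ((Primrec.list_getD 0).comp (Primrec.snd.comp .fst)
      (Primrec.list_idxOf.comp .snd (Primrec.fst.comp .fst))))
  have h1 := PrimrecRel.comp (Primrec.eq (α := List ℕ)) hl .snd
  have h2 := PrimrecRel.comp (Primrec.eq (α := List ℕ)) (hl.comp (Primrec.pair .snd .fst)) .fst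
  exact (h1.and h2).of_eq fun q => by simp only [tupleSim_iff_lookup]

/-- The canonical age of `M`, listing each tuple at all indices with a given first component. -/
noncomputable def canonicalAge (M : Str L) : CompAge L where
  tup i := if TupleIn M ((decode i.unpair.1).getD []) then (decode i.unpair.1).getD [] else []
  str i := M.sub
    (if TupleIn M ((decode i.unpair.1).getD []) then (decode i.unpair.1).getD [] else [])
  tup_mem i := by
    refine inClosure_self ?_
    split_ifs with h
    exacts [h, by simp [TupleIn]]
  gen i x := by
    refine (inClosure_sub_iff (inClosure_self ?_)).symm
    split_ifs with h
    exacts [h, by simp [TupleIn]]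

theorem canonicalAge_tup {M : Str L} {as : List ℕ} (ha : TupleIn M as) (n : ℕ) :
    (canonicalAge M).tup (Nat.pair (encode as) n) = as := by
  simp [canonicalAge, ha]

theorem isCanonicalAgeOf_canonicalAge {s : Set ℕ} {M : Str L} (hM : StrComputableIn s M) :
    IsCanonicalAgeOf s (canonicalAge M) M := by
  refine ⟨?_, fun i => ?_, fun as ha n => ⟨_, Nat.right_le_pair _ n, canonicalAge_tup ha n⟩,
    fun _ => rfl⟩
  · have hd : Primrec fun i : ℕ => ((decode i.unpair.1 : Option (List ℕ)).getD []) :=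
      Primrec.option_getD.comp (Primrec.decode.comp (Primrec.fst.comp Primrec.unpair)) (.const [])
    obtain ⟨c, hc⟩ := CompIn.ite (s := s) ((DecIn.tupleIn hM).comp (CompIn.of_primrec hd))
      (CompIn.of_primrec hd) (CompIn.of_primrec (.const []))
    exact ⟨c, hc⟩
  · change TupleIn M (if _ then _ else _)
    split_ifs with h
    exacts [h, by simp [TupleIn]]

theorem mem_embedInfo_canonicalAge {M : Str L} {as bs : List ℕ} (ha : TupleIn M as)
    (hb : TupleIn M bs) :
    Nat.pair (Nat.pair (encode as) 0) (Nat.pair (encode as)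
      (Nat.pair (Nat.pair (encode bs) 0) (encode bs))) ∈ EmbedInfo (canonicalAge M) ↔
      ClSim M as M bs := by
  have hstr : ∀ {cs : List ℕ}, TupleIn M cs →
      (canonicalAge M).str (Nat.pair (encode cs) 0) = M.sub cs := fun {cs} hc =>
    congrArg M.sub (canonicalAge_tup hc 0)
  have hcl : ClSim (M.sub as) as (M.sub bs) bs ↔ ClSim M as M bs := by
    unfold ClSim
    rw [Str.sub_sub (inClosure_self ha), Str.sub_sub (inClosure_self hb)]
  constructor
  · rintro ⟨k₀, b₀, k₁, b₁, -, -, h, he⟩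
    simp only [Nat.pair_eq_pair, encode_inj] at he
    obtain ⟨rfl, rfl, rfl, rfl⟩ := he
    rwa [hstr ha, hstr hb, hcl] at h
  · intro h
    refine ⟨_, as, _, bs, ?_, ?_, ?_, rfl⟩
    · rw [hstr ha]
      exact inClosure_self ha
    · rw [hstr hb]
      exact inClosure_self hb
    · rwa [hstr ha, hstr hb, hcl]

theorem DecIn.clSim {s : Set ℕ} {M : Str L} (hM : StrComputableIn s M)
    (hEI : ∀ K : CompAge L, IsCanonicalAgeOf s K M → TuringLE (EmbedInfo K) s) :
    DecIn s (fun q : List ℕ × List ℕ =>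
      TupleIn M q.1 ∧ TupleIn M q.2 ∧ ClSim M q.1 M q.2) := by
  have hcode : Primrec fun q : List ℕ × List ℕ =>
      Nat.pair (Nat.pair (encode q.1) 0) (Nat.pair (encode q.1)
        (Nat.pair (Nat.pair (encode q.2) 0) (encode q.2))) := by
    have e1 := (Primrec.encode (α := List ℕ)).comp (Primrec.fst (β := List ℕ))
    have e2 := (Primrec.encode (α := List ℕ)).comp (Primrec.snd (α := List ℕ))
    exact Primrec₂.natPair.comp (Primrec₂.natPair.comp e1 (.const 0))
      (Primrec₂.natPair.comp e1 (Primrec₂.natPair.comp (Primrec₂.natPair.comp e2 (.const 0)) e2))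
  have h := (DecIn.of_setRecIn (hEI _ (isCanonicalAgeOf_canonicalAge hM))).comp
    (CompIn.of_primrec hcode)
  have ht := DecIn.tupleIn hM
  refine ((ht.comp (CompIn.of_primrec .fst)).and
    ((ht.comp (CompIn.of_primrec .snd)).and h)).of_iff fun q => ?_
  exact and_congr_right fun h1 => and_congr_right fun h2 => mem_embedInfo_canonicalAge h1 h2

/-! ### The two implications -/

theorem ClSim.extension_of_append {M : Str L} {as bs cs ds : List ℕ}
    (hc : TupleIn M cs) (hac : ∀ x ∈ as, InClosure M cs x) (hlen : as.length = bs.length)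
    (h : ClSim M (as ++ cs) M (bs ++ ds)) :
    ClSim M ds M cs ∧ (∀ x ∈ bs, InClosure M ds x) ∧
      ∀ h h' : ℕ → ℕ, ds.map h = cs → IsIsoMap (M.sub ds) (M.sub cs) h →
        bs.map h' = as → IsIsoMap (M.sub bs) (M.sub as) h' → bs.map h = bs.map h' := by
  obtain ⟨k, hk, hiso⟩ := h
  rw [List.map_append] at hk
  obtain ⟨rfl, rfl⟩ := List.append_inj hk (by simpa using hlen)
  have hcc : ∀ x ∈ cs, InClosure M (as ++ cs) x := fun x hx =>
    .base (List.mem_append_right _ hx) (hc x hx)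
  have hiso' := hiso.1.isIsoMap_sub_sub hcc
  have hback : ClSim M (cs.map k) M cs := ClSim.symm ⟨k, rfl, hiso'⟩ hc
  refine ⟨hback, fun y hy => ?_, fun h h' hh hi hh' _ => ?_⟩
  · obtain ⟨x, hx, rfl⟩ := List.mem_map.1 hy
    exact hiso'.1.1 x (hac x hx)
  · rw [hh', List.map_map]
    have hid : IsEmbMap (M.sub cs) (M.sub cs) id :=
      ⟨fun x hx => hx, fun x _ y _ hxy => hxy, fun r as _ => by simp, fun f as _ _ => by simp⟩
    have hcomp : IsEmbMap (M.sub cs) (M.sub cs) (h ∘ k) := by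
      refine ⟨fun x hx => hi.1.1 _ (hiso'.1.1 x hx), fun x hx y hy hxy =>
        hiso'.1.2.1 x hx y hy (hi.1.2.1 _ (hiso'.1.1 x hx) _ (hiso'.1.1 y hy) hxy),
        fun r l hl => ?_, fun f l hf hl => ?_⟩
      all_goals
        have hl' : TupleIn (M.sub (cs.map k)) (l.map k) := by
          intro y hy
          obtain ⟨x, hx, rfl⟩ := List.mem_map.1 hy
          exact hiso'.1.1 x (hl x hx)
      · rw [hiso'.1.2.2.1 r l hl, hi.1.2.2.1 r _ hl', List.map_map]
      · rw [Function.comp, hiso'.1.2.2.2 f l hf hl,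
          hi.1.2.2.2 f _ (by simpa using hf) hl', List.map_map]
    rw [List.map_map] at hh
    have hfix := List.map_inj_left.1 (hh.trans (List.map_id _).symm)
    exact (List.map_congr_left fun x hx => hcomp.eq_of_inClosure hid hfix (hac x hx)).trans
      (List.map_id _)

theorem CofUltraFunIn.compCofExtProp {s : Set ℕ} {M : Str L} {E : Set (List ℕ)}
    (hM : StrComputableIn s M)
    (hEI : ∀ K : CompAge L, IsCanonicalAgeOf s K M → TuringLE (EmbedInfo K) s)
    (hE : IsCofinalCollection M E) (hEc : SetRecIn s (ECodes E)) (h : CofUltraFunIn s M E) :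
    CompCofExtProp s M E := by
  let C : List ℕ × List ℕ → Prop := fun q => TupleIn M q.1 ∧ TupleIn M q.2 ∧ ClSim M q.1 M q.2
  let p : List ℕ × List ℕ × List ℕ → List ℕ → Prop := fun q ds =>
    (q.1 ∈ E ∧ TupleIn M q.2.1 ∧ TupleIn M q.2.2 ∧ TupleSim q.1 q.2.1) →
      (TupleIn M ds ∧ TupleSim (q.1 ++ q.2.2) (q.2.1 ++ ds) ∧
        (C (q.1, q.2.1) → C (q.1 ++ q.2.2, q.2.1 ++ ds)))
  have hp : DecIn s (fun q : (List ℕ × List ℕ × List ℕ) × List ℕ => p q.1 q.2) := by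
    have pa : Primrec fun q : (List ℕ × List ℕ × List ℕ) × List ℕ => q.1.1 :=
      Primrec.fst.comp .fst
    have pb : Primrec fun q : (List ℕ × List ℕ × List ℕ) × List ℕ => q.1.2.1 :=
      Primrec.fst.comp (Primrec.snd.comp .fst)
    have pc : Primrec fun q : (List ℕ × List ℕ × List ℕ) × List ℕ => q.1.2.2 :=
      Primrec.snd.comp (Primrec.snd.comp .fst)
    have pd : Primrec fun q : (List ℕ × List ℕ × List ℕ) × List ℕ => q.2 := Primrec.snd
    have hT := DecIn.tupleIn hM
    have hC : DecIn s C := DecIn.clSim hM hEI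
    have hS := DecIn.of_primrecPred (s := s) PrimrecPred.tupleSim
    have pab := CompIn.of_primrec (s := s) (pa.pair pb)
    have pacbd := CompIn.of_primrec (s := s)
      ((Primrec.list_append.comp pa pc).pair (Primrec.list_append.comp pb pd))
    exact (((DecIn.mem_of_eCodes hEc).comp (CompIn.of_primrec pa)).and
      ((hT.comp (CompIn.of_primrec pb)).and ((hT.comp (CompIn.of_primrec pc)).and
        (hS.comp pab)))).imp
      ((hT.comp (CompIn.of_primrec pd)).and ((hS.comp pacbd).and
        ((hC.comp pab).imp (hC.comp pacbd))))
  have hex : ∀ q, ∃ ds, p q ds := by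
    rintro ⟨as, bs, cs⟩
    by_cases hq : as ∈ E ∧ TupleIn M bs ∧ TupleIn M cs ∧ TupleSim as bs
    · obtain ⟨ha, hb, hc, hab⟩ := hq
      obtain ⟨c, hcf⟩ := h
      obtain ⟨e, -, c', -, g, -, hg, rfl, hauto⟩ := hcf as ha bs hb hab
      have hac : TupleIn M (as ++ cs) := fun x hx =>
        (List.mem_append.1 hx).elim (hE.1 as ha x) (hc x)
      refine ⟨cs.map g, fun _ => ⟨fun y hy => ?_, ?_, fun hC => ?_⟩⟩
      · obtain ⟨x, hx, rfl⟩ := List.mem_map.1 hy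
        exact hg.1 x (hc x hx)
      · simpa using tupleSim_map hac hg.2.1
      · have := (hauto hC.2.2).clSim hac
        simp only [List.map_append] at this
        exact ⟨hac, this.tupleIn hac, this⟩
    · exact ⟨[], fun hq' => (hq hq').elim⟩
  obtain ⟨f, ⟨c, hc⟩, hf⟩ := CompIn.exists_search hp hex
  refine ⟨c, fun as bs cs ha hcE hb hac hab => ⟨f (as, bs, cs), hc (as, bs, cs), ?_⟩⟩
  obtain ⟨h1, h2, h3⟩ := hf (as, bs, cs) ⟨ha, hb, hE.1 _ hcE, hab⟩
  exact ⟨h1, h2, fun hcl => ClSim.extension_of_append (hE.1 _ hcE) hac hab.length_eq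
    (h3 ⟨hE.1 _ ha, hb, hcl⟩).2.2⟩

theorem BackForthState.decIn {s : Set ℕ} {M : Str L} {E : Set (List ℕ)}
    (hM : StrComputableIn s M)
    (hEI : ∀ K : CompAge L, IsCanonicalAgeOf s K M → TuringLE (EmbedInfo K) s)
    (hE : IsCofinalCollection M E) (hEc : SetRecIn s (ECodes E)) :
    DecIn s (fun r : (List ℕ × List ℕ) × (List ℕ × List ℕ) =>
      r.1.1 ∈ E ∧ TupleIn M r.1.2 ∧ BackForthState M E r.1 r.2) := by
  have hT := DecIn.tupleIn hM
  have hC := DecIn.clSim hM hEI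
  have hS := DecIn.of_primrecPred (s := s) PrimrecPred.tupleSim
  have hm := DecIn.mem_of_eCodes hEc
  have p1 : CompIn s fun r : (List ℕ × List ℕ) × (List ℕ × List ℕ) => r.1 :=
    CompIn.of_primrec .fst
  have p2 : CompIn s fun r : (List ℕ × List ℕ) × (List ℕ × List ℕ) => r.2 :=
    CompIn.of_primrec .snd
  have q1 : CompIn s fun r : List ℕ × List ℕ => r.1 := CompIn.of_primrec .fst
  have q2 : CompIn s fun r : List ℕ × List ℕ => r.2 := CompIn.of_primrec .snd
  refine ((hm.comp (q1.comp p1)).and ((hT.comp (q2.comp p1)).and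
    ((hT.comp (q1.comp p2)).and ((hT.comp (q2.comp p2)).and ((hS.comp p2).and
      ((hC.comp p1).imp ((hm.comp (q1.comp p2)).and (hC.comp p2)))))))).of_iff fun r => ?_
  unfold BackForthState
  refine and_congr_right fun ha => and_congr_right fun hb => and_congr_right fun h1 =>
    and_congr_right fun h2 => and_congr_right fun _ => ?_
  simp [hE.1 _ ha, hb, h1, h2]

theorem CompCofExtProp.cofUltraFunIn {s : Set ℕ} {M : Str L} {E : Set (List ℕ)}
    (hM : StrComputableIn s M)
    (hEI : ∀ K : CompAge L, IsCanonicalAgeOf s K M → TuringLE (EmbedInfo K) s)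
    (hE : IsCofinalCollection M E) (hEc : SetRecIn s (ECodes E)) (hP : CompCofExtProp s M E) :
    CofUltraFunIn s M E := by
  let V : (List ℕ × List ℕ) → (List ℕ × List ℕ) → Prop := fun p q =>
    p.1 ∈ E ∧ TupleIn M p.2 ∧ BackForthState M E p q
  let next : (List ℕ × List ℕ) → (List ℕ × List ℕ) → List ℕ × List ℕ := fun q w =>
    (q.1 ++ w.1, q.2 ++ w.2)
  have hnext : Primrec₂ next :=
    Primrec.pair (Primrec.list_append.comp (Primrec.fst.comp .fst) (Primrec.fst.comp .snd))
      (Primrec.list_append.comp (Primrec.snd.comp .fst) (Primrec.snd.comp .snd))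
  have hV : DecIn s (fun r : (List ℕ × List ℕ) × (List ℕ × List ℕ) => V r.1 r.2) :=
    BackForthState.decIn hM hEI hE hEc
  let P : (List ℕ × List ℕ) × ℕ × (List ℕ × List ℕ) → List ℕ × List ℕ → Prop := fun r w =>
    V r.1 r.2.2 → V r.1 (next r.2.2 w) ∧
      (r.2.1 ∈ M.dom → r.2.1 ∈ (next r.2.2 w).1 ∧ r.2.1 ∈ (next r.2.2 w).2)
  have hPd : DecIn s (fun t : ((List ℕ × List ℕ) × ℕ × (List ℕ × List ℕ)) × (List ℕ × List ℕ) =>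
      P t.1 t.2) := by
    have tp : Primrec fun t : ((List ℕ × List ℕ) × ℕ × (List ℕ × List ℕ)) × (List ℕ × List ℕ) =>
      t.1.1 := Primrec.fst.comp .fst
    have tn : Primrec fun t : ((List ℕ × List ℕ) × ℕ × (List ℕ × List ℕ)) × (List ℕ × List ℕ) =>
      t.1.2.1 := Primrec.fst.comp (Primrec.snd.comp .fst)
    have tq : Primrec fun t : ((List ℕ × List ℕ) × ℕ × (List ℕ × List ℕ)) × (List ℕ × List ℕ) =>
      t.1.2.2 := Primrec.snd.comp (Primrec.snd.comp .fst)
    have tw : Primrec fun t : ((List ℕ × List ℕ) × ℕ × (List ℕ × List ℕ)) × (List ℕ × List ℕ) =>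
      next t.1.2.2 t.2 := hnext.comp tq .snd
    have hmem : DecIn s (fun r : ℕ × List ℕ => r.1 ∈ r.2) := by
      refine DecIn.of_primrecPred ((PrimrecRel.comp Primrec.nat_lt
        (Primrec.list_idxOf.comp .fst .snd) (Primrec.list_length.comp .snd)).of_eq fun r => ?_)
      exact List.idxOf_lt_length_iff
    exact (hV.comp (CompIn.of_primrec (tp.pair tq))).imp
      ((hV.comp (CompIn.of_primrec (tp.pair tw))).and
        (((DecIn.of_setRecIn hM.1).comp (CompIn.of_primrec tn)).imp
          ((hmem.comp (CompIn.of_primrec (tn.pair (Primrec.fst.comp tw)))).and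
            (hmem.comp (CompIn.of_primrec (tn.pair (Primrec.snd.comp tw)))))))
  have hex : ∀ r, ∃ w, P r w := by
    rintro ⟨p, n, q⟩
    by_cases hr : V p q
    · obtain ⟨w, h1, h2⟩ := hr.2.2.exists_next hE hP n
      exact ⟨w, fun _ => ⟨⟨hr.1, hr.2.1, h1⟩, h2⟩⟩
    · exact ⟨([], []), fun h => (hr h).elim⟩
  obtain ⟨f, hf, hfP⟩ := CompIn.exists_search hPd hex
  have hstep : CompIn s (fun r : (List ℕ × List ℕ) × ℕ × (List ℕ × List ℕ) =>
      next r.2.2 (f r)) :=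
    (CompIn.of_primrec hnext).comp ((CompIn.of_primrec (Primrec.snd.comp .snd)).pair hf)
  let S : (List ℕ × List ℕ) → ℕ → List ℕ × List ℕ := fun p n =>
    Nat.rec p (fun n q => next q (f (p, n, q))) n
  have hS : CompIn s (fun r : (List ℕ × List ℕ) × ℕ => S r.1 r.2) :=
    CompIn.nat_rec (f := fun p : List ℕ × List ℕ => p) (CompIn.of_primrec .id) hstep
  let G : (List ℕ × List ℕ) → ℕ → ℕ := fun p x =>
    (S p (x + 1)).2.getD ((S p (x + 1)).1.idxOf x) 0
  have hG : CompIn s (fun r : (List ℕ × List ℕ) × ℕ => G r.1 r.2) := by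
    have h1 : CompIn s (fun r : (List ℕ × List ℕ) × ℕ => S r.1 (r.2 + 1)) :=
      hS.comp (CompIn.of_primrec (Primrec.fst.pair (Primrec.succ.comp .snd)))
    have h2 : Primrec fun t : (List ℕ × List ℕ) × ℕ => t.1.2.getD (t.1.1.idxOf t.2) 0 :=
      (Primrec.list_getD 0).comp (Primrec.snd.comp .fst)
        (Primrec.list_idxOf.comp .snd (Primrec.fst.comp .fst))
    exact (CompIn.of_primrec h2).comp (h1.pair (CompIn.of_primrec .snd))
  obtain ⟨e, ⟨c, hc⟩, he⟩ := CompIn.exists_index hG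
  refine ⟨c, fun as ha bs hb hab => ⟨e (as, bs), hc (as, bs), ?_⟩⟩
  obtain ⟨c', hc', hcomp⟩ := he (as, bs)
  have hinv : ∀ n, V (as, bs) (S (as, bs) n) := by
    intro n
    induction n with
    | zero => exact ⟨ha, hb, hE.1 _ ha, hb, hab, fun h => ⟨ha, h⟩⟩
    | succ n ih => exact (hfP (_, n, _) ih).1
  have hcov : ∀ n ∈ M.dom, n ∈ (S (as, bs) (n + 1)).1 ∧ n ∈ (S (as, bs) (n + 1)).2 :=
    fun n hn => (hfP (_, n, _) (hinv n)).2 hn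
  have hpre1 : ∀ n, (S (as, bs) n).1 <+: (S (as, bs) (n + 1)).1 := fun n => List.prefix_append _ _
  have hpre2 : ∀ n, (S (as, bs) n).2 <+: (S (as, bs) (n + 1)).2 := fun n => List.prefix_append _ _
  have hmono : Monotone fun n => {x | x ∈ (S (as, bs) n).1} :=
    monotone_nat_of_le_succ fun n x hx => (hpre1 n).subset hx
  have hlist : ∀ l, TupleIn M l → ∃ n, ∀ x ∈ l, x ∈ (S (as, bs) n).1 := fun l hl =>
    ⟨l.sum + 1, fun x hx =>
      hmono (Nat.succ_le_succ (List.le_sum_of_mem hx)) (hcov x (hl x hx)).1⟩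
  have hmap : ∀ n, (S (as, bs) n).1.map (G (as, bs)) = (S (as, bs) n).2 :=
    exists_map_of_prefix_chain (fun n => (hinv n).2.2.2.2.1) hpre1 hpre2
      (fun n x hx => (hcov x ((hinv n).2.2.1 x hx)).1)
  have hbij : BijOnDom M (G (as, bs)) :=
    bijOnDom_of_chain (fun n => (hinv n).2.2.1) (fun n => (hinv n).2.2.2.1)
      (fun n => (hinv n).2.2.2.2.1) hmap hlist fun y hy => ⟨y + 1, (hcov y hy).2⟩
  exact ⟨c', hc', G (as, bs), hcomp, hbij, hmap 0, fun hcl =>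
    isAutoOf_of_chain hbij (fun n => (hinv n).2.2.1)
      (fun n => ((hinv n).2.2.2.2.2 hcl).2) hmap hlist⟩

/-- For an `s`-computable structure `M` with `EmbedInfo(M) ≤_T s` and
an `s`-computable cofinal collection `E`, `M` is `s`-computably cofinally
ultrahomogeneous with respect to `E` iff `M` has the `s`-computable cofinal extension
property with respect to `E`. -/
theorem comp_cofultra_iff_comp_cof_ext_prop {L : Lang} (hL : L.ComputableRep)
    (s : Set ℕ) (M : Str L) (hM : StrComputableIn s M)
    (hEI : ∀ K : CompAge L, IsCanonicalAgeOf s K M → TuringLE (EmbedInfo K) s)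
    (E : Set (List ℕ)) (hE : IsCofinalCollection M E)
    (hEc : SetRecIn s (ECodes E)) :
    CofUltraFunIn s M E ↔ CompCofExtProp s M E := by
  exact ⟨fun h => h.compCofExtProp hM hEI hE hEc, fun h => h.cofUltraFunIn hM hEI hE hEc⟩

end CFL
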